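/- Let n be a degree statistic and let T be a plane rooted tree with |T| ≤ |n|. Then E[N_T(𝒯_n)] = (|n| / (|n|)_{|T|}) · Π_{i≥0} (n(i))_{n_T(i)}, where (x)_q denotes the falling factorial x(x−1)⋯(x−q+1). Consequently, E[N_T(𝒯_n)] ≤ (|n|^{|T|+1} / (|n|)_{|T|}) · π_{p(n)}(T), and for every C > 0 there is a C' ≥ 0 such that whenever |T|² ≤ C|n|, E[N_T(𝒯_n)] ≤ |n| · π_{p(n)}(T) · (1 + C'·|T|²/|n|). -/

import Mathlib

/-!
Common definitions: plane rooted trees, fringe subtree counts, random trees with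
a given degree statistic, Poisson/normal limit notions, conditioned Galton–Watson
trees, and sampling without replacement.
-/

open Filter MeasureTheory
open scoped Topology Classical

/-- A plane rooted tree: a root together with a linearly ordered (possibly empty)
list of subtrees. Structural equality coincides with isomorphism of plane rooted trees. -/
inductive PlaneTree : Type
  | node : List PlaneTree → PlaneTree

namespace PlaneTree

/-- The (out)degree of the root: its number of children. -/
def degree : PlaneTree → ℕ
  | node ts => ts.length

mutual
  /-- The list of all fringe subtrees of a tree (one for each vertex). -/
  def fringe : PlaneTree → List PlaneTree
    | node ts => node ts :: fringeList ts
  def fringeList : List PlaneTree → List PlaneTree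
    | [] => []
    | t :: ts => fringe t ++ fringeList ts
end

/-- The number of vertices `|T|` of a plane tree. -/
def size (T : PlaneTree) : ℕ := T.fringe.length

/-- The degree statistic `n_T` of a tree: `n_T(i)` is the number of vertices with `i` children. -/
noncomputable def degStat (T : PlaneTree) : ℕ →₀ ℕ :=
  Multiset.toFinsupp ((T.fringe.map degree : List ℕ) : Multiset ℕ)

/-- `N_{T'}(T)`: the number of fringe subtrees of `T` equal to `T'`. -/
noncomputable def countTree (T' T : PlaneTree) : ℕ :=
  (T.fringe.filter fun t => decide (t = T')).length

/-- `N_m(T)` for a degree statistic `m`: the number of fringe subtrees of `T`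
with degree statistic `m`. -/
noncomputable def countStat (m : ℕ →₀ ℕ) (T : PlaneTree) : ℕ :=
  (T.fringe.filter fun t => decide (degStat t = m)).length

/-- `N_m(T)` for an integer `m`: the number of fringe subtrees of `T` of size `m`. -/
noncomputable def countSize (m : ℕ) (T : PlaneTree) : ℕ :=
  (T.fringe.filter fun t => decide (size t = m)).length

end PlaneTree

/-- `n : ℕ →₀ ℕ` is a degree statistic: `∑ n(i) = 1 + ∑ i·n(i)`. -/
def IsDegStat (n : ℕ →₀ ℕ) : Prop :=
  (n.sum fun _ c => c) = 1 + n.sum fun i c => i * c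

/-- `|n| = ∑_i n(i)`, the size of a degree statistic. -/
def nsize (n : ℕ →₀ ℕ) : ℕ := n.sum fun _ c => c

/-- The set `𝕋_n` of plane trees with degree statistic `n`. -/
def treesWith (n : ℕ →₀ ℕ) : Set PlaneTree := {T | PlaneTree.degStat T = n}

/-- `|𝕋_n|`, the number of plane trees with degree statistic `n`. -/
noncomputable def numTrees (n : ℕ →₀ ℕ) : ℕ := (treesWith n).ncard

/-- The probability that a uniformly random tree `𝒯_n ∈ 𝕋_n` satisfies `P`. -/
noncomputable def prob (n : ℕ →₀ ℕ) (P : PlaneTree → Prop) : ℝ :=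
  (({T ∈ treesWith n | P T}).ncard : ℝ) / (numTrees n : ℝ)

/-- The expectation `E[f(𝒯_n)]` of an `ℕ`-valued functional of the uniformly
random tree `𝒯_n ∈ 𝕋_n`. -/
noncomputable def expect (n : ℕ →₀ ℕ) (f : PlaneTree → ℕ) : ℝ :=
  ∑' k : ℕ, (k : ℝ) * prob n (fun T => f T = k)

/-- The variance `Var[f(𝒯_n)]`. -/
noncomputable def variance (n : ℕ →₀ ℕ) (f : PlaneTree → ℕ) : ℝ :=
  expect n (fun T => (f T) ^ 2) - (expect n f) ^ 2

/-- The empirical degree distribution `p_i(n) = n(i)/|n|`. -/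
noncomputable def empDist (n : ℕ →₀ ℕ) (i : ℕ) : ℝ := (n i : ℝ) / (nsize n : ℝ)

/-- `π_p(T) = ∏_{i ≥ 0} p_i^{n_T(i)}`. -/
noncomputable def piDist (p : ℕ → ℝ) (T : PlaneTree) : ℝ :=
  (PlaneTree.degStat T).prod fun i c => p i ^ c

/-- `π_p(𝕋_m) = |𝕋_m| · ∏_{i ≥ 0} p_i^{m(i)}`. -/
noncomputable def piSet (p : ℕ → ℝ) (m : ℕ →₀ ℕ) : ℝ :=
  (numTrees m : ℝ) * m.prod fun i c => p i ^ c

/-- Condition 1: the `nseq κ` are degree statistics with `|n_κ| → ∞` and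
`p_i(n_κ) → p_i` for every `i`, where `p` is a probability distribution on `ℕ`. -/
def Condition1 (nseq : ℕ → (ℕ →₀ ℕ)) (p : ℕ → ℝ) : Prop :=
  (∀ κ, IsDegStat (nseq κ)) ∧
  Tendsto (fun κ => nsize (nseq κ)) atTop atTop ∧
  (∀ i, 0 ≤ p i) ∧ HasSum p 1 ∧
  (∀ i, Tendsto (fun κ => empDist (nseq κ) i) atTop (𝓝 (p i)))

/-- Condition 2: in addition, `∑ i² p_i(n_κ) → ∑ i² p_i < ∞`. -/
def Condition2 (nseq : ℕ → (ℕ →₀ ℕ)) (p : ℕ → ℝ) : Prop :=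
  Summable (fun i : ℕ => (i : ℝ) ^ 2 * p i) ∧
  Tendsto (fun κ => ∑' i : ℕ, (i : ℝ) ^ 2 * empDist (nseq κ) i) atTop
    (𝓝 (∑' i : ℕ, (i : ℝ) ^ 2 * p i))

/-- `σ_p² = ∑_{i ≥ 0} (i-1)² p_i`. -/
noncomputable def sigmaSq (p : ℕ → ℝ) : ℝ := ∑' i : ℕ, ((i : ℝ) - 1) ^ 2 * p i

/-- The point probabilities of the Poisson distribution `Po(lam)`. -/
noncomputable def poissonPMF (lam : ℝ) (k : ℕ) : ℝ :=
  Real.exp (-lam) * lam ^ k / (Nat.factorial k : ℝ)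

/-- The `q`-th moment of the Poisson distribution `Po(lam)`. -/
noncomputable def poissonMoment (lam : ℝ) (q : ℕ) : ℝ :=
  ∑' k : ℕ, (k : ℝ) ^ q * poissonPMF lam k

/-- The standard normal cumulative distribution function. -/
noncomputable def stdNormalCDF (x : ℝ) : ℝ :=
  ∫ t in Set.Iic x, Real.exp (-t ^ 2 / 2) / Real.sqrt (2 * Real.pi)

/-- The total variation distance between the law of `f(𝒯_n)` and `Po(lam)`:
`sup_A |P(f(𝒯_n) ∈ A) − Po(lam)(A)|`. -/
noncomputable def dTVPoisson (n : ℕ →₀ ℕ) (f : PlaneTree → ℕ) (lam : ℝ) : ℝ :=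
  ⨆ A : Set ℕ, |prob n (fun T => f T ∈ A) - ∑' k : ℕ, A.indicator (poissonPMF lam) k|

/-- A probability distribution on `ℕ` is nonlattice: the gcd of the differences of
points of its support is `1`. -/
def Nonlattice (p : ℕ → ℝ) : Prop :=
  ∀ h : ℕ, (∀ i j : ℕ, 0 < p i → 0 < p j → (h : ℤ) ∣ (i : ℤ) - (j : ℤ)) → h = 1

/-- The partition function `P(|𝒯_p| = n)` of a Galton–Watson tree with offspring
distribution `p`. -/
noncomputable def gwZ (p : ℕ → ℝ) (n : ℕ) : ℝ :=
  ∑' T : PlaneTree, if PlaneTree.size T = n then piDist p T else 0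

/-- `P(𝒯_{p,n} ∈ {T | P T})` for the conditioned Galton–Watson tree `𝒯_{p,n}`. -/
noncomputable def probGW (p : ℕ → ℝ) (n : ℕ) (P : PlaneTree → Prop) : ℝ :=
  (∑' T : PlaneTree, if PlaneTree.size T = n ∧ P T then piDist p T else 0) / gwZ p n

/-- The expectation `E[f(𝒯_{p,n})]` for an `ℕ`-valued functional. -/
noncomputable def expectGW (p : ℕ → ℝ) (n : ℕ) (f : PlaneTree → ℕ) : ℝ :=
  ∑' k : ℕ, (k : ℝ) * probGW p n (fun T => f T = k)

/-- The filter `n → ∞` along the sizes `n` for which the conditioning `|𝒯_p| = n`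
is well defined. -/
noncomputable def gwFilter (p : ℕ → ℝ) : Filter ℕ :=
  atTop ⊓ Filter.principal {n | 0 < gwZ p n}

/-- A positive function on the positive reals is slowly varying at infinity. -/
def SlowlyVarying (L : ℝ → ℝ) : Prop :=
  (∀ x : ℝ, 0 < x → 0 < L x) ∧
  ∀ c : ℝ, 0 < c → Tendsto (fun x : ℝ => L (c * x) / L x) atTop (𝓝 1)

/-- The probability that a uniformly random permutation of `Fin n` satisfies `P`. -/
noncomputable def probPerm {n : ℕ} (P : Equiv.Perm (Fin n) → Prop) : ℝ :=
  ((Finset.univ.filter P).card : ℝ) / ((Finset.univ : Finset (Equiv.Perm (Fin n))).card : ℝ)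

/-- `S_m = ∑_{i=1}^m d_{τ(i)}`: the sum of `m` of the values `d`, drawn without
replacement via the permutation `τ`. -/
def sampleSum {n : ℕ} (d : Fin n → ℤ) (m : ℕ) (τ : Equiv.Perm (Fin n)) : ℤ :=
  ∑ i : Fin n, if (i : ℕ) < m then d (τ i) else 0

/-- The mean `d̄` of the values `d`. -/
noncomputable def dbar {n : ℕ} (d : Fin n → ℤ) : ℝ := (∑ i : Fin n, (d i : ℝ)) / n

/-- `Q = ∑_i (d_i − d̄)²`. -/
noncomputable def Qval {n : ℕ} (d : Fin n → ℤ) : ℝ := ∑ i : Fin n, ((d i : ℝ) - dbar d) ^ 2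

/-- `σ̂² = (m/n)(1 − m/n) Q`. -/
noncomputable def sigHatSq {n : ℕ} (d : Fin n → ℤ) (m : ℕ) : ℝ :=
  ((m : ℝ) / n) * (1 - (m : ℝ) / n) * Qval d

/-- The empirical frequency `p_k(d) = #{i : d_i = k}/n`. -/
noncomputable def empFreq {n : ℕ} (d : Fin n → ℤ) (k : ℤ) : ℝ :=
  ((Finset.univ.filter (fun i => d i = k)).card : ℝ) / n

/-- The characteristic function `φ_{S_m}(t) = E[exp(i t S_m)]` of the sample sum. -/
noncomputable def charFn {n : ℕ} (d : Fin n → ℤ) (m : ℕ) (t : ℝ) : ℂ :=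
  (Fintype.card (Equiv.Perm (Fin n)) : ℂ)⁻¹ *
    ∑ τ : Equiv.Perm (Fin n), Complex.exp (Complex.I * t * (sampleSum d m τ : ℂ))

/-- A probability distribution on `ℤ` is nonlattice. -/
def NonlatticeZ (p : ℤ → ℝ) : Prop :=
  ∀ h : ℕ, (∀ i j : ℤ, 0 < p i → 0 < p j → (h : ℤ) ∣ i - j) → h = 1

namespace PlaneTree

/-- The degree statistic of a forest. -/
noncomputable def forestStat (ts : List PlaneTree) : ℕ →₀ ℕ :=
  Multiset.toFinsupp (((fringeList ts).map degree : List ℕ) : Multiset ℕ)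

/-- The number of fringe subtrees of a forest that are equal to `T`. -/
noncomputable def forestCount (T : PlaneTree) (ts : List PlaneTree) : ℕ :=
  ((fringeList ts).filter fun t => decide (t = T)).length

/-- Turn the first `i` trees of a forest into the children of a new root. -/
def graft (i : ℕ) (ws : List PlaneTree) : List PlaneTree :=
  node (ws.take i) :: ws.drop i

theorem fringeList_append (us vs : List PlaneTree) :
    fringeList (us ++ vs) = fringeList us ++ fringeList vs := by
  induction us with
  | nil => simp [fringeList]
  | cons t us ih => simp [fringeList, ih]

@[simp] theorem forestStat_nil : forestStat [] = 0 := by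
  simp [forestStat, fringeList]

theorem forestStat_append (us vs : List PlaneTree) :
    forestStat (us ++ vs) = forestStat us + forestStat vs := by
  simp only [forestStat, fringeList_append, List.map_append, ← Multiset.coe_add, map_add]

theorem degStat_node (ts : List PlaneTree) :
    degStat (node ts) = Finsupp.single ts.length 1 + forestStat ts := by
  simp only [degStat, forestStat, fringe, List.map_cons, degree, ← Multiset.cons_coe,
    ← Multiset.singleton_add, map_add, Multiset.toFinsupp_singleton]

theorem forestStat_cons (t : PlaneTree) (ts : List PlaneTree) :
    forestStat (t :: ts) = degStat t + forestStat ts := by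
  simp only [forestStat, degStat, fringeList, List.map_append, ← Multiset.coe_add, map_add]

theorem forestStat_singleton (t : PlaneTree) : forestStat [t] = degStat t := by
  simp [forestStat_cons]

@[simp] theorem forestCount_nil (T : PlaneTree) : forestCount T [] = 0 := by
  simp [forestCount, fringeList]

theorem forestCount_append (T : PlaneTree) (us vs : List PlaneTree) :
    forestCount T (us ++ vs) = forestCount T us + forestCount T vs := by
  simp [forestCount, fringeList_append]

theorem forestCount_singleton (T t : PlaneTree) : forestCount T [t] = countTree T t := by
  simp [forestCount, countTree, fringeList]

theorem forestCount_node_cons (T : PlaneTree) (us vs : List PlaneTree) :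
    forestCount T (node us :: vs) =
      (if node us = T then 1 else 0) + forestCount T (us ++ vs) := by
  rw [forestCount_append]
  simp only [forestCount, fringeList, fringe, List.cons_append, List.filter_cons,
    List.filter_append]
  split_ifs <;> simp_all
  all_goals omega

theorem forestCount_graft (T : PlaneTree) (i : ℕ) (ws : List PlaneTree) :
    forestCount T (graft i ws) =
      (if (graft i ws).head? = some T then 1 else 0) + forestCount T ws := by
  rw [graft, forestCount_node_cons, List.take_append_drop]
  simp

theorem forestStat_graft {i : ℕ} {ws : List PlaneTree} (h : i ≤ ws.length) :
    forestStat (graft i ws) = Finsupp.single i 1 + forestStat ws := by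
  rw [graft, forestStat_cons, degStat_node, add_assoc, ← forestStat_append,
    List.take_append_drop, List.length_take, min_eq_left h]

theorem graft_injective (i : ℕ) : Function.Injective (graft i) := by
  intro us vs h
  simp only [graft, List.cons.injEq, node.injEq] at h
  rw [← List.take_append_drop i us, h.1, h.2, List.take_append_drop]

end PlaneTree

open PlaneTree

theorem nsize_add (a b : ℕ →₀ ℕ) : nsize (a + b) = nsize a + nsize b :=
  Finsupp.sum_add_index' (fun _ => rfl) (fun _ _ _ => rfl)

theorem nsize_single (i c : ℕ) : nsize (Finsupp.single i c) = c :=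
  Finsupp.sum_single_index rfl

theorem nsize_eq_zero_iff {n : ℕ →₀ ℕ} : nsize n = 0 ↔ n = 0 := by
  constructor
  · intro h
    ext i
    by_contra hi
    have hi' : i ∈ n.support := Finsupp.mem_support_iff.2 hi
    exact hi (Finset.sum_eq_zero_iff.1 h i hi')
  · rintro rfl
    exact Finsupp.sum_zero_index

/-- The number of edges `∑ i·n(i)` described by a degree statistic. -/
def edgeSum (n : ℕ →₀ ℕ) : ℕ := n.sum fun i c => i * c

theorem edgeSum_add (a b : ℕ →₀ ℕ) : edgeSum (a + b) = edgeSum a + edgeSum b :=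
  Finsupp.sum_add_index' (fun _ => Nat.mul_zero _) (fun _ _ _ => Nat.mul_add _ _ _)

theorem edgeSum_single (i c : ℕ) : edgeSum (Finsupp.single i c) = i * c :=
  Finsupp.sum_single_index (Nat.mul_zero _)

theorem edgeSum_zero : edgeSum 0 = 0 := Finsupp.sum_zero_index

theorem nsize_toFinsupp (s : Multiset ℕ) : nsize (Multiset.toFinsupp s) = s.card :=
  Multiset.toFinsupp_sum_eq s

theorem nsize_degStat (T : PlaneTree) : nsize (degStat T) = T.size := by
  simp [degStat, nsize_toFinsupp, size]

mutual
  theorem nsize_degStat_eq_edgeSum : ∀ T : PlaneTree,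
      nsize (degStat T) = 1 + edgeSum (degStat T)
    | node ts => by
      have h := nsize_forestStat_eq_edgeSum ts
      simp only [degStat_node, nsize_add, edgeSum_add, nsize_single, edgeSum_single] at *
      omega
  theorem nsize_forestStat_eq_edgeSum : ∀ ts : List PlaneTree,
      nsize (forestStat ts) = ts.length + edgeSum (forestStat ts)
    | [] => by simp [edgeSum_zero, nsize_eq_zero_iff]
    | t :: ts => by
      have h := nsize_degStat_eq_edgeSum t
      have h' := nsize_forestStat_eq_edgeSum ts
      simp only [forestStat_cons, nsize_add, edgeSum_add, List.length_cons] at *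
      omega
end

theorem size_pos (T : PlaneTree) : 0 < T.size := by
  rw [← nsize_degStat, nsize_degStat_eq_edgeSum]
  omega

theorem forestStat_eq_zero_iff {ts : List PlaneTree} : forestStat ts = 0 ↔ ts = [] := by
  constructor
  · intro h
    have := nsize_forestStat_eq_edgeSum ts
    rw [h, nsize_eq_zero_iff.2 rfl] at this
    exact List.length_eq_zero_iff.1 (by omega)
  · rintro rfl
    simp

theorem single_add_sub_single {n : ℕ →₀ ℕ} {i : ℕ} (hi : i ∈ n.support) :
    Finsupp.single i 1 + (n - Finsupp.single i 1) = n := by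
  apply add_tsub_cancel_of_le
  rw [Finsupp.single_le_iff]
  exact Nat.one_le_iff_ne_zero.2 (Finsupp.mem_support_iff.1 hi)

/-- The set of forests of `r` trees with degree statistic `n`. -/
def forestSet (n : ℕ →₀ ℕ) (r : ℕ) : Set (List PlaneTree) :=
  {ts | forestStat ts = n ∧ ts.length = r}

theorem mem_forestSet_succ {n : ℕ →₀ ℕ} {r : ℕ} {ts : List PlaneTree} :
    ts ∈ forestSet n (r + 1) ↔
      ∃ i ∈ n.support, ∃ ws ∈ forestSet (n - Finsupp.single i 1) (r + i), graft i ws = ts := by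
  constructor
  · rintro ⟨hn, hr⟩
    match ts, hr with
    | node us :: vs, hr =>
      have hg : graft us.length (us ++ vs) = node us :: vs := by simp [graft]
      have hs := forestStat_graft (i := us.length) (ws := us ++ vs) (by simp)
      rw [hg, hn] at hs
      refine ⟨us.length, ?_, us ++ vs, ⟨?_, ?_⟩, hg⟩
      · simp [hs]
      · rw [hs, add_tsub_cancel_left]
      · simp at hr ⊢
        omega
  · rintro ⟨i, hi, ws, ⟨hs, hl⟩, rfl⟩
    refine ⟨?_, ?_⟩
    · rw [forestStat_graft (by omega), hs, single_add_sub_single hi]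
    · simp [graft, hl]

theorem nsize_sub_single {n : ℕ →₀ ℕ} {i : ℕ} (hi : i ∈ n.support) :
    nsize n = nsize (n - Finsupp.single i 1) + 1 := by
  conv_lhs => rw [← single_add_sub_single hi, nsize_add, nsize_single, add_comm]

theorem edgeSum_sub_single {n : ℕ →₀ ℕ} {i : ℕ} (hi : i ∈ n.support) :
    edgeSum n = edgeSum (n - Finsupp.single i 1) + i := by
  conv_lhs => rw [← single_add_sub_single hi, edgeSum_add, edgeSum_single, mul_one, add_comm]

theorem forestSet_finite (n : ℕ →₀ ℕ) (r : ℕ) : (forestSet n r).Finite := by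
  induction hm : nsize n generalizing n r with
  | zero =>
    rw [nsize_eq_zero_iff] at hm
    subst hm
    exact (Set.finite_singleton []).subset fun ts h => forestStat_eq_zero_iff.1 h.1
  | succ m ih =>
    cases r with
    | zero => exact (Set.finite_singleton []).subset fun ts h => List.length_eq_zero_iff.1 h.2
    | succ r =>
      refine (n.support.finite_toSet.biUnion fun i hi =>
        (ih (n - Finsupp.single i 1) (r + i) ?_).image (graft i)).subset fun ts hts => ?_
      · have := nsize_sub_single hi
        omega
      · simpa using mem_forestSet_succ.1 hts

/-- The forests of `r` trees with degree statistic `n`. -/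
noncomputable def forests (n : ℕ →₀ ℕ) (r : ℕ) : Finset (List PlaneTree) :=
  (forestSet_finite n r).toFinset

theorem mem_forests {n : ℕ →₀ ℕ} {r : ℕ} {ts : List PlaneTree} :
    ts ∈ forests n r ↔ forestStat ts = n ∧ ts.length = r := by
  simp [forests, forestSet]

theorem forests_succ (n : ℕ →₀ ℕ) (r : ℕ) :
    forests n (r + 1) = n.support.biUnion fun i =>
      (forests (n - Finsupp.single i 1) (r + i)).image (graft i) := by
  ext ts
  have := mem_forestSet_succ (n := n) (r := r) (ts := ts)
  simp only [Finset.mem_biUnion, Finset.mem_image, forests, Set.Finite.mem_toFinset]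
  exact this

theorem sum_forests_succ (n : ℕ →₀ ℕ) (r : ℕ) (f : List PlaneTree → ℕ) :
    ∑ ts ∈ forests n (r + 1), f ts =
      ∑ i ∈ n.support, ∑ ws ∈ forests (n - Finsupp.single i 1) (r + i), f (graft i ws) := by
  rw [forests_succ, Finset.sum_biUnion]
  · exact Finset.sum_congr rfl fun i _ =>
      Finset.sum_image fun _ _ _ _ h => graft_injective i h
  · intro i _ j _ hij
    rw [Function.onFun, Finset.disjoint_left]
    rintro ts hi hj
    simp only [Finset.mem_image, mem_forests] at hi hj
    obtain ⟨us, ⟨-, hu⟩, rfl⟩ := hi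
    obtain ⟨vs, ⟨-, hv⟩, h⟩ := hj
    simp only [graft, List.cons.injEq, node.injEq] at h
    have := congrArg List.length h.1
    simp only [List.length_take] at this
    omega

theorem forests_zero_of_ne {n : ℕ →₀ ℕ} (hn : n ≠ 0) : forests n 0 = ∅ := by
  ext ts
  simp only [mem_forests, List.length_eq_zero_iff, Finset.notMem_empty, iff_false, not_and]
  rintro h rfl
  exact hn (by simp [← h])

theorem forests_zero_zero : forests 0 0 = {[]} := by
  ext ts
  simp only [mem_forests, List.length_eq_zero_iff, Finset.mem_singleton, forestStat_eq_zero_iff,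
    and_self]

/-- The product of the factorials of the entries. -/
noncomputable def factProd (n : ℕ →₀ ℕ) : ℕ := n.prod fun _ c => c.factorial

theorem factProd_of_subset {n : ℕ →₀ ℕ} {s : Finset ℕ} (h : n.support ⊆ s) :
    factProd n = ∏ i ∈ s, (n i).factorial :=
  Finsupp.prod_of_support_subset n h _ fun _ _ => Nat.factorial_zero

theorem factProd_zero : factProd 0 = 1 := Finsupp.prod_zero_index

theorem factProd_pos (n : ℕ →₀ ℕ) : 0 < factProd n :=
  Finset.prod_pos fun _ _ => Nat.factorial_pos _

theorem factProd_sub_single {n : ℕ →₀ ℕ} {i : ℕ} (hi : i ∈ n.support) :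
    factProd n = n i * factProd (n - Finsupp.single i 1) := by
  have hsub : (n - Finsupp.single i 1).support ⊆ n.support := by
    intro j hj
    simp only [Finsupp.mem_support_iff, Finsupp.tsub_apply] at hj ⊢
    omega
  rw [factProd_of_subset subset_rfl, factProd_of_subset hsub,
    ← Finset.mul_prod_erase _ _ hi, ← Finset.mul_prod_erase _ _ hi, ← mul_assoc]
  congr 1
  · simpa using (Nat.mul_factorial_pred (Finsupp.mem_support_iff.1 hi)).symm
  · refine Finset.prod_congr rfl fun j hj => ?_
    simp [(Finset.ne_of_mem_erase hj).symm]

theorem sum_add_mul_eq (n : ℕ →₀ ℕ) (r : ℕ) :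
    ∑ i ∈ n.support, (r + i) * n i = r * nsize n + edgeSum n := by
  simp only [nsize, edgeSum, Finsupp.sum, Finset.mul_sum, add_mul, Finset.sum_add_distrib]

theorem card_forests_mul_factProd {m : ℕ} {n : ℕ →₀ ℕ} {r : ℕ} (hm : nsize n = m + 1)
    (hr : nsize n = r + edgeSum n) :
    (forests n r).card * factProd n = r * m.factorial := by
  induction m generalizing n r with
  | zero =>
    have hn : n ≠ 0 := by
      rintro rfl
      rw [nsize_eq_zero_iff.2 rfl] at hm
      omega
    cases r with
    | zero => simp [forests_zero_of_ne hn]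
    | succ r =>
      obtain ⟨i, hi⟩ := Finsupp.support_nonempty_iff.2 hn
      have h1 := single_add_sub_single hi
      have h2 := nsize_sub_single hi
      have h3 := edgeSum_sub_single hi
      have h4 : n - Finsupp.single i 1 = 0 := nsize_eq_zero_iff.1 (by omega)
      have hr0 : r = 0 := by omega
      have hi0 : i = 0 := by omega
      subst hr0 hi0
      rw [h4, add_zero] at h1
      subst h1
      rw [Finset.card_eq_sum_ones, sum_forests_succ, Finsupp.support_single (hb := one_ne_zero),
        factProd_of_subset Finsupp.support_single_subset]
      simp [forests_zero_zero]
  | succ m ih =>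
    have hn : n ≠ 0 := by
      rintro rfl
      rw [nsize_eq_zero_iff.2 rfl] at hm
      omega
    cases r with
    | zero => simp [forests_zero_of_ne hn]
    | succ r =>
      have key : ∀ i ∈ n.support,
          (forests (n - Finsupp.single i 1) (r + i)).card * factProd n =
            m.factorial * ((r + i) * n i) := by
        intro i hi
        have h2 := nsize_sub_single hi
        have h3 := edgeSum_sub_single hi
        have := ih (n := n - Finsupp.single i 1) (r := r + i) (by omega) (by omega)
        rw [factProd_sub_single hi, mul_left_comm, this]
        ring
      rw [Finset.card_eq_sum_ones, sum_forests_succ, Finset.sum_mul]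
      simp only [← Finset.card_eq_sum_ones]
      rw [Finset.sum_congr rfl key, ← Finset.mul_sum, sum_add_mul_eq, Nat.factorial_succ]
      have : r * nsize n + edgeSum n = (r + 1) * (m + 1) := by
        rw [hm] at hr ⊢
        linarith
      rw [this]
      ring

/-- The total number of fringe subtrees equal to `T` in the forests of `r` trees with degree
statistic `n`. -/
noncomputable def forestTotal (T : PlaneTree) (n : ℕ →₀ ℕ) (r : ℕ) : ℕ :=
  ∑ ts ∈ forests n r, forestCount T ts

theorem forestTotal_zero (T : PlaneTree) (n : ℕ →₀ ℕ) : forestTotal T n 0 = 0 :=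
  Finset.sum_eq_zero fun ts hts => by
    rw [List.length_eq_zero_iff.1 (mem_forests.1 hts).2, forestCount_nil]

theorem forestTotal_succ (T : PlaneTree) (n : ℕ →₀ ℕ) (r : ℕ) :
    forestTotal T n (r + 1) =
      ((forests n (r + 1)).filter fun ts => ts.head? = some T).card +
        ∑ i ∈ n.support, forestTotal T (n - Finsupp.single i 1) (r + i) := by
  rw [Finset.card_filter, sum_forests_succ, ← Finset.sum_add_distrib, forestTotal,
    sum_forests_succ]
  refine Finset.sum_congr rfl fun i _ => ?_
  rw [forestTotal, ← Finset.sum_add_distrib]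
  exact Finset.sum_congr rfl fun ws _ => forestCount_graft T i ws

theorem card_filter_head_eq (T : PlaneTree) (q : ℕ →₀ ℕ) (r : ℕ) :
    ((forests (q + degStat T) (r + 1)).filter fun ts => ts.head? = some T).card =
      (forests q r).card := by
  symm
  refine Finset.card_bij (fun ts _ => T :: ts) ?_ ?_ ?_
  · intro ts hts
    rw [mem_forests] at hts
    simp [mem_forests, forestStat_cons, hts.1, hts.2, add_comm]
  · intro a _ b _ h
    exact (List.cons.inj h).2
  · intro ts hts
    rw [Finset.mem_filter, mem_forests] at hts
    obtain ⟨⟨h1, h2⟩, h3⟩ := hts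
    match ts, h3 with
    | t :: us, h3 =>
      obtain rfl : t = T := by simpa using h3
      refine ⟨us, ?_, rfl⟩
      rw [forestStat_cons, add_comm] at h1
      exact mem_forests.2 ⟨add_right_cancel h1, by simpa using h2⟩

theorem forestTotal_eq_zero {T : PlaneTree} {n : ℕ →₀ ℕ} (h : ¬ degStat T ≤ n) (r : ℕ) :
    forestTotal T n r = 0 := by
  induction hm : nsize n generalizing n r with
  | zero =>
    rw [nsize_eq_zero_iff] at hm
    subst hm
    refine Finset.sum_eq_zero fun ts hts => ?_
    rw [forestStat_eq_zero_iff.1 (mem_forests.1 hts).1, forestCount_nil]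
  | succ m ih =>
    cases r with
    | zero => exact forestTotal_zero T n
    | succ r =>
      rw [forestTotal_succ, Finset.card_eq_zero.2, Finset.sum_eq_zero, add_zero]
      · intro i hi
        have := nsize_sub_single hi
        exact ih (fun h' => h (h'.trans tsub_le_self)) _ (by omega)
      · refine Finset.filter_eq_empty_iff.2 fun ts hts hT => h ?_
        rw [mem_forests] at hts
        match ts, hT with
        | t :: us, hT =>
          obtain rfl : t = T := by simpa using hT
          rw [← hts.1, forestStat_cons]
          exact le_self_add

theorem forestTotal_succ_add (T : PlaneTree) (q : ℕ →₀ ℕ) (r : ℕ) :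
    forestTotal T (q + degStat T) (r + 1) =
      (forests q r).card +
        ∑ i ∈ q.support, forestTotal T (q - Finsupp.single i 1 + degStat T) (r + i) := by
  rw [forestTotal_succ, card_filter_head_eq]
  congr 1
  rw [← Finset.sum_subset (s₁ := q.support)]
  · refine Finset.sum_congr rfl fun i hi => ?_
    conv_lhs => rw [← single_add_sub_single hi, add_assoc, add_tsub_cancel_left]
  · intro i hi
    rw [Finsupp.mem_support_iff] at hi ⊢
    rw [Finsupp.add_apply]
    omega
  · intro i hi hq
    refine forestTotal_eq_zero (fun h => ?_) _
    have h1 := h i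
    rw [Finsupp.mem_support_iff] at hi
    rw [Finsupp.notMem_support_iff] at hq
    simp only [Finsupp.tsub_apply, Finsupp.add_apply, Finsupp.single_eq_same] at h1 hi
    omega

theorem forestTotal_mul_factProd (T : PlaneTree) {m : ℕ} {q : ℕ →₀ ℕ} {r : ℕ}
    (hm : nsize q = m) (hr : nsize q + 1 = r + edgeSum q) :
    forestTotal T (q + degStat T) r * factProd q = r * m.factorial := by
  induction m generalizing q r with
  | zero =>
    rw [nsize_eq_zero_iff] at hm
    subst hm
    rw [nsize_eq_zero_iff.2 rfl, edgeSum_zero] at hr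
    obtain rfl : r = 0 + 1 := by omega
    rw [forestTotal_succ_add]
    simp [forests_zero_zero, factProd_zero]
  | succ m ih =>
    cases r with
    | zero => simp [forestTotal_zero]
    | succ r =>
      have key : ∀ i ∈ q.support,
          forestTotal T (q - Finsupp.single i 1 + degStat T) (r + i) * factProd q =
            m.factorial * ((r + i) * q i) := by
        intro i hi
        have h2 := nsize_sub_single hi
        have h3 := edgeSum_sub_single hi
        have := ih (q := q - Finsupp.single i 1) (r := r + i) (by omega) (by omega)
        rw [factProd_sub_single hi, mul_left_comm, this]
        ring
      rw [forestTotal_succ_add, add_mul, card_forests_mul_factProd hm (by omega), Finset.sum_mul,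
        Finset.sum_congr rfl key, ← Finset.mul_sum, sum_add_mul_eq, Nat.factorial_succ]
      have : r + (r * nsize q + edgeSum q) = (r + 1) * (m + 1) := by
        rw [hm] at hr ⊢
        linarith
      calc r * m.factorial + m.factorial * (r * nsize q + edgeSum q)
          = m.factorial * (r + (r * nsize q + edgeSum q)) := by ring
        _ = _ := by rw [this]; ring

theorem treesWith_finite (n : ℕ →₀ ℕ) : (treesWith n).Finite := by
  refine Set.Finite.of_finite_image (f := fun t => [t])
    ((forestSet_finite n 1).subset ?_) fun _ _ _ _ h => (List.cons.inj h).1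
  rintro _ ⟨t, ht, rfl⟩
  exact ⟨(forestStat_singleton t).trans ht, rfl⟩

theorem forests_one (n : ℕ →₀ ℕ) :
    forests n 1 = (treesWith_finite n).toFinset.image fun t => [t] := by
  ext ts
  simp only [mem_forests, Finset.mem_image, Set.Finite.mem_toFinset, treesWith, Set.mem_ofPred_eq]
  constructor
  · rintro ⟨h, hl⟩
    obtain ⟨t, rfl⟩ := List.length_eq_one_iff.1 hl
    exact ⟨t, by rwa [← forestStat_singleton], rfl⟩
  · rintro ⟨t, h, rfl⟩
    exact ⟨by rwa [forestStat_singleton], rfl⟩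

theorem numTrees_eq_card_forests (n : ℕ →₀ ℕ) : numTrees n = (forests n 1).card := by
  rw [forests_one, Finset.card_image_of_injective _ fun _ _ h => (List.cons.inj h).1, numTrees,
    Set.ncard_eq_toFinset_card _ (treesWith_finite n)]

theorem sum_countTree_eq_forestTotal (T : PlaneTree) (n : ℕ →₀ ℕ) :
    ∑ t ∈ (treesWith_finite n).toFinset, countTree T t = forestTotal T n 1 := by
  rw [forestTotal, forests_one, Finset.sum_image fun _ _ _ _ h => (List.cons.inj h).1]
  exact Finset.sum_congr rfl fun t _ => (forestCount_singleton T t).symm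

theorem expect_eq_sum_div (n : ℕ →₀ ℕ) (f : PlaneTree → ℕ) :
    expect n f = (∑ t ∈ (treesWith_finite n).toFinset, f t : ℕ) / (numTrees n : ℝ) := by
  set S := (treesWith_finite n).toFinset with hS
  have hcard : ∀ k, ({T ∈ treesWith n | f T = k}).ncard = (S.filter fun T => f T = k).card := by
    intro k
    rw [← Set.ncard_coe_finset]
    congr 1
    ext T
    simp [hS]
  have hsum : expect n f = ∑ k ∈ S.image f, (k : ℝ) * prob n (fun T => f T = k) := by
    refine tsum_eq_sum fun k hk => ?_
    rw [prob, hcard, Finset.filter_eq_empty_iff.2]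
    · simp
    · rintro T hT rfl
      exact hk (Finset.mem_image_of_mem f hT)
  rw [hsum, Nat.cast_sum, Finset.sum_div, ← Finset.sum_fiberwise_of_maps_to
    (t := S.image f) (g := f) fun T hT => Finset.mem_image_of_mem f hT]
  refine Finset.sum_congr rfl fun k _ => ?_
  rw [prob, hcard, Finset.sum_congr rfl
    (g := fun _ => (k : ℝ) / numTrees n) fun T hT => by rw [(Finset.mem_filter.1 hT).2]]
  rw [Finset.sum_const, nsmul_eq_mul]
  ring

theorem factProd_add (q t : ℕ →₀ ℕ) :
    factProd (q + t) = factProd q * t.prod fun i c => ((q + t) i).descFactorial c := by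
  have h1 : q.support ⊆ (q + t).support := fun i hi => by
    rw [Finsupp.mem_support_iff] at hi ⊢
    rw [Finsupp.add_apply]
    omega
  have h2 : t.support ⊆ (q + t).support := fun i hi => by
    rw [Finsupp.mem_support_iff] at hi ⊢
    rw [Finsupp.add_apply]
    omega
  rw [factProd_of_subset subset_rfl, factProd_of_subset h1,
    Finsupp.prod_of_support_subset t h2 _ fun _ _ => Nat.descFactorial_zero _,
    ← Finset.prod_mul_distrib]
  refine Finset.prod_congr rfl fun i _ => ?_
  rw [← Nat.factorial_mul_descFactorial (n := (q + t) i) (k := t i) (by simp)]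
  simp

theorem prod_descFactorial_eq_zero {n t : ℕ →₀ ℕ} (h : ¬ t ≤ n) :
    t.prod (fun i c => ((n i).descFactorial c : ℝ)) = 0 := by
  rw [Finsupp.le_def] at h
  push Not at h
  obtain ⟨i, hi⟩ := h
  refine Finset.prod_eq_zero (i := i) (Finsupp.mem_support_iff.2 (by omega)) ?_
  simp only [Nat.descFactorial_of_lt hi, Nat.cast_zero]

theorem expect_countTree_eq {n : ℕ →₀ ℕ} {T : PlaneTree} (hn : IsDegStat n) :
    expect n (countTree T) =
      (nsize n : ℝ) / ((nsize n).descFactorial T.size : ℝ) *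
        (degStat T).prod (fun i c => ((n i).descFactorial c : ℝ)) := by
  rw [expect_eq_sum_div, sum_countTree_eq_forestTotal, numTrees_eq_card_forests]
  by_cases h : degStat T ≤ n
  · obtain ⟨q, rfl⟩ := exists_add_of_le h
    rw [add_comm] at hn ⊢
    have hn' : nsize (q + degStat T) = 1 + edgeSum (q + degStat T) := hn
    have hT := nsize_degStat_eq_edgeSum T
    obtain ⟨m, hm⟩ : ∃ m, nsize (q + degStat T) = m + 1 := ⟨_, hn'.trans (add_comm _ _)⟩
    have hF := card_forests_mul_factProd hm hn'
    rw [nsize_add, edgeSum_add] at hn'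
    have hG := forestTotal_mul_factProd T (q := q) (r := 1) rfl (by omega)
    have hk : T.size ≤ nsize (q + degStat T) := by
      rw [nsize_add, nsize_degStat]
      omega
    have hD := Nat.factorial_mul_descFactorial hk
    have hq : nsize (q + degStat T) - T.size = nsize q := by
      rw [nsize_add, nsize_degStat]
      omega
    have hpos : 0 < (nsize (q + degStat T)).descFactorial T.size :=
      Nat.pos_of_ne_zero fun h0 => by
        rw [Nat.descFactorial_eq_zero_iff_lt] at h0
        omega
    have hprod : (degStat T).prod (fun i c => (((q + degStat T) i).descFactorial c : ℝ)) =
        ((degStat T).prod fun i c => ((q + degStat T) i).descFactorial c : ℕ) := by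
      simp [Finsupp.prod]
    rw [hprod]
    have hP := factProd_add q (degStat T)
    set A := (degStat T).prod fun i c => ((q + degStat T) i).descFactorial c
    have hq0 := factProd_pos q
    have hF0 : 0 < (forests (q + degStat T) 1).card := by
      refine Nat.pos_of_ne_zero fun h0 => ?_
      rw [h0, zero_mul, one_mul] at hF
      exact m.factorial_ne_zero hF.symm
    rw [hq, hm, Nat.factorial_succ] at hD
    rw [hm] at hpos ⊢
    have key : forestTotal T (q + degStat T) 1 * (m + 1).descFactorial T.size =
        (m + 1) * A * (forests (q + degStat T) 1).card := by
      refine Nat.eq_of_mul_eq_mul_left hq0 ?_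
      calc factProd q * (forestTotal T (q + degStat T) 1 * (m + 1).descFactorial T.size)
          = (forestTotal T (q + degStat T) 1 * factProd q) * (m + 1).descFactorial T.size := by
            ring
        _ = (m + 1) * (1 * m.factorial) := by rw [hG, one_mul, hD, one_mul]
        _ = (m + 1) * ((forests (q + degStat T) 1).card * (factProd q * A)) := by
            rw [← hF, hP]
        _ = _ := by ring
    have keyR : (forestTotal T (q + degStat T) 1 : ℝ) * ((m + 1).descFactorial T.size : ℕ) =
        ((m + 1 : ℕ) : ℝ) * A * (forests (q + degStat T) 1).card := by exact_mod_cast key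
    have hposR : (0 : ℝ) < ((m + 1).descFactorial T.size : ℕ) := by exact_mod_cast hpos
    have hF0R : (0 : ℝ) < (forests (q + degStat T) 1).card := by exact_mod_cast hF0
    rw [div_mul_eq_mul_div, div_eq_div_iff hF0R.ne' hposR.ne', keyR]
  · rw [forestTotal_eq_zero h, prod_descFactorial_eq_zero h]
    simp

theorem piDist_empDist_mul_pow {n : ℕ →₀ ℕ} (hn : nsize n ≠ 0) (T : PlaneTree) :
    piDist (empDist n) T * (nsize n : ℝ) ^ T.size = (degStat T).prod fun i c => (n i : ℝ) ^ c := by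
  have hn' : (nsize n : ℝ) ≠ 0 := by exact_mod_cast hn
  rw [← nsize_degStat T]
  conv_lhs => rw [nsize.eq_1 (degStat T)]
  rw [piDist, Finsupp.sum, ← Finset.prod_pow_eq_pow_sum, Finsupp.prod, ← Finset.prod_mul_distrib,
    Finsupp.prod]
  refine Finset.prod_congr rfl fun i _ => ?_
  rw [empDist, ← mul_pow, div_mul_cancel₀ _ hn']

theorem piDist_empDist_nonneg (n : ℕ →₀ ℕ) (T : PlaneTree) : 0 ≤ piDist (empDist n) T := by
  rw [piDist]
  refine Finset.prod_nonneg fun i _ => ?_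
  simp only [empDist]
  positivity

theorem expect_countTree_le {n : ℕ →₀ ℕ} {T : PlaneTree} (hn : IsDegStat n) :
    expect n (countTree T) ≤
      (nsize n : ℝ) ^ (T.size + 1) / ((nsize n).descFactorial T.size : ℝ) *
        piDist (empDist n) T := by
  have hn0 : nsize n ≠ 0 := by
    have : nsize n = 1 + edgeSum n := hn
    omega
  have h : (nsize n : ℝ) ^ (T.size + 1) / ((nsize n).descFactorial T.size : ℝ) *
        piDist (empDist n) T = (nsize n : ℝ) / ((nsize n).descFactorial T.size : ℝ) *
        (degStat T).prod (fun i c => (n i : ℝ) ^ c) := by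
    rw [← piDist_empDist_mul_pow hn0]
    ring
  rw [expect_countTree_eq hn, h]
  gcongr
  refine Finset.prod_le_prod (fun _ _ => Nat.cast_nonneg _) fun i _ => ?_
  simpa using Nat.cast_le (α := ℝ).2 (Nat.descFactorial_le_pow (n i) (degStat T i))

theorem pow_le_descFactorial_mul_exp_of_two_mul_le {m k : ℕ} (h : 2 * k ≤ m) :
    (m : ℝ) ^ k ≤ (m.descFactorial k : ℝ) * Real.exp (2 * (k : ℝ) ^ 2 / m) := by
  induction k with
  | zero => simp
  | succ k ih =>
    have hm : (0 : ℝ) < m := by exact_mod_cast (by omega : 0 < m)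
    have hk : (2 : ℝ) * (k + 1) ≤ m := by exact_mod_cast h
    have hk0 : (0 : ℝ) ≤ k := Nat.cast_nonneg k
    have step : (m : ℝ) ≤ (m - k) * Real.exp ((4 * k + 2) / m) := by
      have h1 : (4 * k + 2) / (m : ℝ) + 1 ≤ Real.exp ((4 * k + 2) / m) := Real.add_one_le_exp _
      have h2 : (m : ℝ) ≤ (m - k) * ((4 * k + 2) / (m : ℝ) + 1) := by
        rw [div_add_one hm.ne', ← mul_div_assoc, le_div_iff₀ hm]
        nlinarith
      exact h2.trans (mul_le_mul_of_nonneg_left h1 (by linarith))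
    have hexp : Real.exp (2 * ((k + 1 : ℕ) : ℝ) ^ 2 / m) =
        Real.exp (2 * (k : ℝ) ^ 2 / m) * Real.exp ((4 * k + 2) / m) := by
      rw [← Real.exp_add]
      congr 1
      push_cast
      ring
    rw [pow_succ, hexp, Nat.descFactorial_succ, Nat.cast_mul, Nat.cast_sub (by omega)]
    calc (m : ℝ) ^ k * m
        ≤ ((m.descFactorial k : ℝ) * Real.exp (2 * (k : ℝ) ^ 2 / m)) *
            ((m - k) * Real.exp ((4 * k + 2) / m)) :=
          mul_le_mul (ih (by omega)) step hm.le (by positivity)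
      _ = _ := by ring

theorem pow_le_descFactorial_mul_exp {m k : ℕ} (h : k ≤ m) :
    (m : ℝ) ^ k ≤ (m.descFactorial k : ℝ) * Real.exp (4 * ((k : ℝ) ^ 2 / m)) := by
  obtain rfl | hm := Nat.eq_zero_or_pos m
  · obtain rfl : k = 0 := by omega
    simp
  have hmR : (0 : ℝ) < m := by exact_mod_cast hm
  by_cases hk : 2 * k ≤ m
  · refine (pow_le_descFactorial_mul_exp_of_two_mul_le hk).trans ?_
    gcongr
    rw [mul_div_assoc]
    have : 0 ≤ (k : ℝ) ^ 2 / m := by positivity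
    linarith
  · have hkR : (m : ℝ) ≤ 2 * k := by exact_mod_cast (by omega : m ≤ 2 * k)
    have h1 : (m : ℝ) ^ m / (m.factorial : ℝ) ≤ Real.exp m :=
      Real.pow_div_factorial_le_exp m hmR.le m
    have h2 : (m : ℝ) ≤ 4 * ((k : ℝ) ^ 2 / m) := by
      rw [← mul_div_assoc, le_div_iff₀ hmR]
      nlinarith
    rw [div_le_iff₀ (by exact_mod_cast m.factorial_pos)] at h1
    have h3 : ((m - k).factorial : ℝ) ≤ (m : ℝ) ^ (m - k) := by
      have : (m - k).factorial ≤ m ^ (m - k) :=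
        (Nat.factorial_le_pow _).trans (Nat.pow_le_pow_left (Nat.sub_le _ _) _)
      exact_mod_cast this
    have hf : (0 : ℝ) < ((m - k).factorial : ℝ) := by exact_mod_cast (m - k).factorial_pos
    refine le_of_mul_le_mul_right ?_ hf
    calc (m : ℝ) ^ k * ((m - k).factorial : ℝ) ≤ (m : ℝ) ^ k * (m : ℝ) ^ (m - k) := by gcongr
      _ = (m : ℝ) ^ m := by rw [← pow_add, Nat.add_sub_cancel' h]
      _ ≤ Real.exp m * (m.factorial : ℝ) := h1
      _ ≤ Real.exp (4 * ((k : ℝ) ^ 2 / m)) * (m.factorial : ℝ) := by gcongr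
      _ = _ := by
        rw [← Nat.factorial_mul_descFactorial h]
        push_cast
        ring

theorem exp_le_one_add_mul_exp {x b : ℝ} (hx : 0 ≤ x) (hb : x ≤ b) :
    Real.exp x ≤ 1 + x * Real.exp b := by
  have h1 : -x + 1 ≤ Real.exp (-x) := Real.add_one_le_exp _
  have h2 : Real.exp x * (-x + 1) ≤ Real.exp x * Real.exp (-x) :=
    mul_le_mul_of_nonneg_left h1 (Real.exp_pos x).le
  rw [← Real.exp_add, add_neg_cancel, Real.exp_zero] at h2
  have h3 : x * Real.exp x ≤ x * Real.exp b := by gcongr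
  linarith

theorem expect_countTree_le_of_sq_le {C : ℝ} {n : ℕ →₀ ℕ} {T : PlaneTree} (hn : IsDegStat n)
    (hT : T.size ≤ nsize n) (hC : (T.size : ℝ) ^ 2 ≤ C * (nsize n : ℝ)) :
    expect n (countTree T) ≤ (nsize n : ℝ) * piDist (empDist n) T *
      (1 + 4 * Real.exp (4 * C) * (T.size : ℝ) ^ 2 / (nsize n : ℝ)) := by
  have hm : (0 : ℝ) < nsize n := by exact_mod_cast (size_pos T).trans_le hT
  have hD : (0 : ℝ) < ((nsize n).descFactorial T.size : ℝ) := by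
    have : (nsize n).descFactorial T.size ≠ 0 := fun h0 => by
      rw [Nat.descFactorial_eq_zero_iff_lt] at h0
      omega
    exact_mod_cast Nat.pos_of_ne_zero this
  have hratio : (nsize n : ℝ) ^ T.size / ((nsize n).descFactorial T.size : ℝ) ≤
      1 + 4 * Real.exp (4 * C) * (T.size : ℝ) ^ 2 / (nsize n : ℝ) := by
    rw [div_le_iff₀' hD]
    refine (pow_le_descFactorial_mul_exp hT).trans (mul_le_mul_of_nonneg_left ?_ hD.le)
    have hx : (T.size : ℝ) ^ 2 / nsize n ≤ C := by rwa [div_le_iff₀ hm]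
    refine (exp_le_one_add_mul_exp (b := 4 * C) (by positivity) (by linarith)).trans_eq ?_
    ring
  calc expect n (countTree T)
      ≤ (nsize n : ℝ) ^ (T.size + 1) / ((nsize n).descFactorial T.size : ℝ) *
          piDist (empDist n) T := expect_countTree_le hn
    _ = (nsize n : ℝ) * piDist (empDist n) T *
          ((nsize n : ℝ) ^ T.size / ((nsize n).descFactorial T.size : ℝ)) := by ring
    _ ≤ _ := mul_le_mul_of_nonneg_left hratio
          (mul_nonneg hm.le (piDist_empDist_nonneg n T))


/-- Lemma 3.1: exact formula and estimates for `E[N_T(𝒯_n)]`. -/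
theorem expect_countTree_formula :
    (∀ (n : ℕ →₀ ℕ) (T : PlaneTree), IsDegStat n → PlaneTree.size T ≤ nsize n →
      expect n (PlaneTree.countTree T) =
        (nsize n : ℝ) / ((nsize n).descFactorial (PlaneTree.size T) : ℝ) *
          (PlaneTree.degStat T).prod (fun i c => ((n i).descFactorial c : ℝ)) ∧
      expect n (PlaneTree.countTree T) ≤
        (nsize n : ℝ) ^ (PlaneTree.size T + 1)
            / ((nsize n).descFactorial (PlaneTree.size T) : ℝ) *
          piDist (empDist n) T) ∧
    (∀ C : ℝ, 0 < C → ∃ C' : ℝ, 0 ≤ C' ∧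
      ∀ (n : ℕ →₀ ℕ) (T : PlaneTree), IsDegStat n → PlaneTree.size T ≤ nsize n →
        (PlaneTree.size T : ℝ) ^ 2 ≤ C * (nsize n : ℝ) →
        expect n (PlaneTree.countTree T) ≤
          (nsize n : ℝ) * piDist (empDist n) T *
            (1 + C' * (PlaneTree.size T : ℝ) ^ 2 / (nsize n : ℝ))) := by
  refine ⟨fun n T hn _ => ⟨expect_countTree_eq hn, expect_countTree_le hn⟩, fun C _ =>
    ⟨4 * Real.exp (4 * C), by positivity, fun n T hn hT hC =>
      expect_countTree_le_of_sq_le hn hT hC⟩⟩
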